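/- arXiv:math/9707215 — 4 statements merged into one kernel-verified Lean document; each statement's English description precedes it below -/
import Mathlib

section
/- Let a,b,c,d be integers with ad − bc = 1, and set N := 2ac + ad + bc + 2bd and D := c² + cd + d². Then N is odd, and gcd(N, D) is either 1 or 3. Consequently the fraction N/(2D) is either already in lowest terms or becomes a fraction in lowest terms after dividing numerator and denominator by 3. -/
/-- If `N² + 3` is a multiple of `D`, then `gcd(N, D)` divides `3`. -/
theorem gcd_eq_one_or_three_of_dvd_sq_add_three {N D : ℤ} (h : D ∣ N ^ 2 + 3) :
    Int.gcd N D = 1 ∨ Int.gcd N D = 3 := by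
  have hN : (Int.gcd N D : ℤ) ∣ N ^ 2 := dvd_pow (Int.gcd_dvd_left ..) two_ne_zero
  have h3 : (Int.gcd N D : ℤ) ∣ 3 := (dvd_add_right hN).1 ((Int.gcd_dvd_right ..).trans h)
  exact (Nat.dvd_prime Nat.prime_three).1 (by exact_mod_cast h3)

/-- An odd integer coprime to `m` is coprime to `2 * m`. -/
theorem gcd_two_mul_eq_one_of_odd {n m : ℤ} (hn : Odd n) (h : Int.gcd n m = 1) :
    Int.gcd n (2 * m) = 1 :=
  Int.isCoprime_iff_gcd_eq_one.1
    ((Int.isCoprime_two_right.2 hn).mul_right (Int.isCoprime_iff_gcd_eq_one.2 h))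

/-- For integers `a,b,c,d` with `ad − bc = 1`, with `N = 2ac + ad + bc + 2bd` and
`D = c² + cd + d²`:  `N` is odd, `gcd(N,D)` is `1` or `3`, and consequently the
fraction `N/(2D)` is either already in lowest terms, or becomes a fraction in lowest
terms after dividing numerator and denominator by `3`. -/
theorem corner_numerator_odd_gcd_one_or_three (a b c d : ℤ) (h : a * d - b * c = 1) :
    Odd (2 * a * c + a * d + b * c + 2 * b * d) ∧
    (Int.gcd (2 * a * c + a * d + b * c + 2 * b * d) (c ^ 2 + c * d + d ^ 2) = 1 ∨
     Int.gcd (2 * a * c + a * d + b * c + 2 * b * d) (c ^ 2 + c * d + d ^ 2) = 3) ∧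
    (Int.gcd (2 * a * c + a * d + b * c + 2 * b * d) (2 * (c ^ 2 + c * d + d ^ 2)) = 1 ∨
     ((3 : ℤ) ∣ (2 * a * c + a * d + b * c + 2 * b * d) ∧
      (3 : ℤ) ∣ (c ^ 2 + c * d + d ^ 2) ∧
      Int.gcd ((2 * a * c + a * d + b * c + 2 * b * d) / 3)
        (2 * ((c ^ 2 + c * d + d ^ 2) / 3)) = 1)) := by
  have hodd : Odd (2 * a * c + a * d + b * c + 2 * b * d) :=
    ⟨a * c + b * c + b * d, by linear_combination h⟩
  have hdvd : c ^ 2 + c * d + d ^ 2 ∣ (2 * a * c + a * d + b * c + 2 * b * d) ^ 2 + 3 :=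
    ⟨4 * (a ^ 2 + a * b + b ^ 2), by linear_combination -3 * (a * d - b * c + 1) * h⟩
  have hgcd := gcd_eq_one_or_three_of_dvd_sq_add_three hdvd
  refine ⟨hodd, hgcd, hgcd.imp (gcd_two_mul_eq_one_of_odd hodd) fun h3 => ?_⟩
  generalize 2 * a * c + a * d + b * c + 2 * b * d = N at *
  generalize c ^ 2 + c * d + d ^ 2 = D at *
  have hN : (3 : ℤ) ∣ N := by simpa [h3] using Int.gcd_dvd_left N D
  have hD : (3 : ℤ) ∣ D := by simpa [h3] using Int.gcd_dvd_right N D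
  refine ⟨hN, hD, gcd_two_mul_eq_one_of_odd ?_ ?_⟩
  · exact Int.Odd.of_mul_right (m := 3) ((Int.mul_ediv_cancel' hN).symm ▸ hodd)
  · simpa [h3] using Int.gcd_ediv_gcd_ediv_gcd (i := N) (j := D) (by simp [h3])
end

section
/- Let a,b,c,d be integers with ad − bc = 1, set N := 2ac + ad + bc + 2bd and D := c² + cd + d², and suppose N/(2D) = v/w where v,w are coprime integers with w > 0. Then 2D = w or 2D = 3w; consequently the imaginary part √3/(2D) of the corner image (a·ρ+b)/(c·ρ+d) equals √3/w or √3/(3w). -/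
/-- The finite corner `ρ = (1 + √3·i)/2` of the standard fundamental domain of
`PSL(2,ℤ)`. -/
noncomputable def modularCorner : ℂ := (1 + Real.sqrt 3 * Complex.I) / 2

theorem modularCorner_re : modularCorner.re = 1 / 2 := by
  simp [modularCorner]

theorem modularCorner_im : modularCorner.im = Real.sqrt 3 / 2 := by
  simp [modularCorner]

theorem normSq_intCast_mul_modularCorner_add (c d : ℤ) :
    Complex.normSq ((c : ℂ) * modularCorner + d) = ((c ^ 2 + c * d + d ^ 2 : ℤ) : ℝ) := by
  have h3 : Real.sqrt 3 ^ 2 = 3 := Real.sq_sqrt (by norm_num)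
  simp only [Complex.normSq_apply, Complex.add_re, Complex.add_im, Complex.mul_re,
    Complex.mul_im, Complex.intCast_re, Complex.intCast_im, modularCorner_re, modularCorner_im]
  push_cast
  linear_combination (c : ℝ) ^ 2 / 4 * h3

/-- The imaginary part of the image of the corner under an element of `SL(2,ℤ)`. -/
theorem im_moebius_modularCorner (a b c d : ℤ) (h : a * d - b * c = 1) :
    (((a : ℂ) * modularCorner + b) / ((c : ℂ) * modularCorner + d)).im
      = Real.sqrt 3 / ((2 * (c ^ 2 + c * d + d ^ 2) : ℤ) : ℝ) := by
  have hR : (a : ℝ) * d - b * c = 1 := by exact_mod_cast h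
  rw [Complex.div_im, normSq_intCast_mul_modularCorner_add, ← sub_div, Int.cast_mul,
    Int.cast_ofNat, ← div_div]
  congr 1
  simp only [Complex.add_re, Complex.add_im, Complex.mul_re,
    Complex.mul_im, Complex.intCast_re, Complex.intCast_im, modularCorner_re, modularCorner_im]
  linear_combination Real.sqrt 3 / 2 * hR

/-- For integers `a,b,c,d` with `ad − bc = 1`, `N = 2ac + ad + bc + 2bd`,
`D = c² + cd + d²`, if `N/(2D) = v/w` in lowest terms with `w > 0`, then `2D = w` or
`2D = 3w`; consequently the imaginary part `√3/(2D)` of the corner image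
`(a·ρ+b)/(c·ρ+d)` equals `√3/w` or `√3/(3w)`. -/
theorem corner_denominator_w_or_three_w (a b c d : ℤ) (h : a * d - b * c = 1)
    (v w : ℤ) (hw : 0 < w) (hcop : IsCoprime v w)
    (hvw : ((2 * a * c + a * d + b * c + 2 * b * d : ℤ) : ℝ)
        / (2 * ((c ^ 2 + c * d + d ^ 2 : ℤ) : ℝ)) = (v : ℝ) / (w : ℝ)) :
    (2 * (c ^ 2 + c * d + d ^ 2) = w ∨ 2 * (c ^ 2 + c * d + d ^ 2) = 3 * w) ∧
    ((((a : ℂ) * modularCorner + b) / ((c : ℂ) * modularCorner + d)).im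
        = Real.sqrt 3 / (w : ℝ) ∨
     (((a : ℂ) * modularCorner + b) / ((c : ℂ) * modularCorner + d)).im
        = Real.sqrt 3 / (3 * (w : ℝ))) := by
  have key : (2 * a * c + a * d + b * c + 2 * b * d) ^ 2 + 3
      = 4 * (c ^ 2 + c * d + d ^ 2) * (a ^ 2 + a * b + b ^ 2) := by
    linear_combination (-3) * (a * d - b * c + 1) * h
  have hD : 0 < c ^ 2 + c * d + d ^ 2 := by
    have h0 : 0 ≤ c ^ 2 + c * d + d ^ 2 := by
      nlinarith [sq_nonneg (c + d), sq_nonneg c, sq_nonneg d]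
    refine lt_of_le_of_ne h0 fun h1 => ?_
    rw [← h1] at key
    nlinarith [sq_nonneg (2 * a * c + a * d + b * c + 2 * b * d)]
  rw [im_moebius_modularCorner a b c d h]
  generalize 2 * a * c + a * d + b * c + 2 * b * d = N at key hvw
  generalize a ^ 2 + a * b + b ^ 2 = E at key
  generalize c ^ 2 + c * d + d ^ 2 = D at key hvw hD ⊢
  have hcross : N * w = v * (2 * D) := by
    have hwR : (w : ℝ) ≠ 0 := by exact_mod_cast hw.ne'
    have hDR : (2 * (D : ℝ)) ≠ 0 := by exact_mod_cast (by positivity : 2 * D ≠ 0)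
    rw [div_eq_div_iff hDR hwR] at hvw
    exact_mod_cast hvw
  obtain ⟨g, hg⟩ : w ∣ 2 * D := hcop.symm.dvd_of_dvd_mul_left ⟨N, by rw [← hcross, mul_comm]⟩
  have hN : N = v * g := by
    apply mul_right_cancel₀ hw.ne'
    rw [hcross, hg]
    ring
  have hgpos : 0 < g := pos_of_mul_pos_right (hg ▸ by positivity : 0 < w * g) hw.le
  have hg3 : g ∣ 3 := ⟨2 * w * E - v ^ 2 * g, by
    rw [hN] at key
    linear_combination key + 2 * E * hg⟩
  have hcases : 2 * D = w ∨ 2 * D = 3 * w := by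
    have hle := Int.le_of_dvd (by norm_num) hg3
    interval_cases g <;> omega
  refine ⟨hcases, hcases.imp ?_ ?_⟩ <;> intro h2 <;> rw [h2]
  push_cast
  rfl
end

section
/- Let α and β be real numbers with 0 < α < 1 and 1 < β < 2. Then (β² − 2β)/(β² − 1) < (α² + 2α)/(α² − 1) if and only if β < (α + 2)/(2α + 1); moreover (β² − 2β)/(β² − 1) = (α² + 2α)/(α² − 1) if and only if β = (α + 2)/(2α + 1). -/
/-- For `0 < α < 1` and `1 < β < 2`:
`(β² − 2β)/(β² − 1) < (α² + 2α)/(α² − 1)` iff `β < (α + 2)/(2α + 1)`, and equality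
holds iff `β = (α + 2)/(2α + 1)`. -/
theorem miss_hit_criterion (α β : ℝ) (hα0 : 0 < α) (hα1 : α < 1)
    (hβ1 : 1 < β) (hβ2 : β < 2) :
    ((β ^ 2 - 2 * β) / (β ^ 2 - 1) < (α ^ 2 + 2 * α) / (α ^ 2 - 1) ↔
      β < (α + 2) / (2 * α + 1)) ∧
    ((β ^ 2 - 2 * β) / (β ^ 2 - 1) = (α ^ 2 + 2 * α) / (α ^ 2 - 1) ↔
      β = (α + 2) / (2 * α + 1)) := by
  have hβ : 0 < β ^ 2 - 1 := by nlinarith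
  have hα : 0 < 1 - α ^ 2 := by nlinarith
  have hαβ : 0 < α + β := by linarith
  have hN : 0 < 2 * α + 1 := by linarith
  have hg : (α ^ 2 + 2 * α) / (α ^ 2 - 1) = -(α ^ 2 + 2 * α) / (1 - α ^ 2) := by
    rw [← neg_sub 1 (α ^ 2), div_neg, neg_div]
  have factor : (β ^ 2 - 2 * β) * (1 - α ^ 2) - -(α ^ 2 + 2 * α) * (β ^ 2 - 1) =
      (α + β) * (β * (2 * α + 1) - (α + 2)) := by ring
  rw [hg, div_lt_div_iff₀ hβ hα, div_eq_div_iff hβ.ne' hα.ne', lt_div_iff₀ hN,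
    eq_div_iff hN.ne', ← sub_neg, ← sub_eq_zero, factor]
  constructor
  · rw [← mul_zero (α + β), mul_lt_mul_iff_right₀ hαβ, sub_neg]
  · rw [mul_eq_zero_iff_left hαβ.ne', sub_eq_zero]
end

section
/- Let q, q′ be real numbers with 0 < q < q′, and let d, d′ be real numbers with d′ ≠ 0 and 1 < −d/d′ < 2. Then (d′² − (d + d′)²)/((q + q′)² − q′²) > (d² − d′²)/(q′² − q²) if and only if −d/d′ < (q + 2q′)/(2q + q′); and the two sides are equal if and only if −d/d′ = (q + 2q′)/(2q + q′). (Taking d = q_{n−1}θ − p_{n−1}, d′ = q_nθ − p_n, q = q_{n−1}, q′ = q_n for consecutive continued fraction convergents of θ with a_{n+1} = 1, the left inequality compares the squared critical parameter values t² at which the 'miss' and 'hit' events occur in the Minkowski geodesic continued fraction, and the right-hand condition is β_n < N(α_n) with α_n = q_{n−1}/q_n, β_n = −d/d′, N(z) = (z+2)/(2z+1).) -/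
/-- For reals `0 < q < q′` and `d, d′` with `d′ ≠ 0` and `1 < −d/d′ < 2`:
`(d′² − (d + d′)²)/((q + q′)² − q′²) > (d² − d′²)/(q′² − q²)` iff
`−d/d′ < (q + 2q′)/(2q + q′)`, and the two sides are equal iff
`−d/d′ = (q + 2q′)/(2q + q′)`. -/
theorem critical_value_comparison (q q' d d' : ℝ) (hq : 0 < q) (hqq' : q < q')
    (hd' : d' ≠ 0) (h1 : 1 < -d / d') (h2 : -d / d' < 2) :
    ((d' ^ 2 - (d + d') ^ 2) / ((q + q') ^ 2 - q' ^ 2)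
        > (d ^ 2 - d' ^ 2) / (q' ^ 2 - q ^ 2) ↔
      -d / d' < (q + 2 * q') / (2 * q + q')) ∧
    ((d' ^ 2 - (d + d') ^ 2) / ((q + q') ^ 2 - q' ^ 2)
        = (d ^ 2 - d' ^ 2) / (q' ^ 2 - q ^ 2) ↔
      -d / d' = (q + 2 * q') / (2 * q + q')) := by
  obtain ⟨b, rfl⟩ : ∃ b, d = -b * d' := ⟨-d / d', by field_simp⟩
  have hb : -(-b * d') / d' = b := by field_simp
  rw [hb] at h1 h2 ⊢
  have hq' : 0 < q' := hq.trans hqq'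
  have hD₁ : 0 < (q + q') ^ 2 - q' ^ 2 := by nlinarith [mul_pos hq hq']
  have hD₂ : 0 < q' ^ 2 - q ^ 2 := by nlinarith
  have hpos : 0 < d' ^ 2 * (q + b * q') * (2 * q + q') /
      (((q + q') ^ 2 - q' ^ 2) * (q' ^ 2 - q ^ 2)) := by
    have hb₀ : 0 < b := one_pos.trans h1
    positivity
  have key : (d' ^ 2 - (-b * d' + d') ^ 2) / ((q + q') ^ 2 - q' ^ 2)
      - ((-b * d') ^ 2 - d' ^ 2) / (q' ^ 2 - q ^ 2)
      = d' ^ 2 * (q + b * q') * (2 * q + q') /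
        (((q + q') ^ 2 - q' ^ 2) * (q' ^ 2 - q ^ 2)) * ((q + 2 * q') / (2 * q + q') - b) := by
    have hs : 2 * q + q' ≠ 0 := by positivity
    rw [div_sub_div _ _ hD₁.ne' hD₂.ne', div_sub' hs, div_mul_div_comm,
      div_eq_div_iff (mul_pos hD₁ hD₂).ne' (mul_ne_zero (mul_pos hD₁ hD₂).ne' hs)]
    ring
  constructor
  · rw [gt_iff_lt, ← sub_pos, key, mul_pos_iff_of_pos_left hpos, sub_pos]
  · rw [← sub_eq_zero, key, mul_eq_zero_iff_left hpos.ne', sub_eq_zero, eq_comm]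
end
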